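/- Let X be a nonempty type and let G₁ and G₂ be groups that are geometrically X-equivalent. If G₁ is torsion-free, then G₂ is torsion-free. -/

import Mathlib

/-- The `G`-closure of a normal subgroup `N` of `W`: the intersection of the kernels of all
homomorphisms `μ : W →* G` with `N ≤ ker μ` (over an empty family this is all of `W`). -/
def gClosure (G : Type*) [Group G] {W : Type*} [Group W] (N : Subgroup W) : Subgroup W :=
  ⨅ μ : {μ : W →* G // N ≤ MonoidHom.ker μ}, MonoidHom.ker μ.1

theorem mem_gClosure_iff {G W : Type*} [Group G] [Group W] {N : Subgroup W} {w : W} :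
    w ∈ gClosure G N ↔ ∀ μ : W →* G, N ≤ μ.ker → μ w = 1 := by
  simp [gClosure, Subgroup.mem_iInf]

/-- §3.8, Proposition 8.1: if `G₁` and `G₂` are geometrically `X`-equivalent (`X` nonempty)
and `G₁` is torsion-free, then `G₂` is torsion-free. -/
theorem torsionFree_of_geomEquiv {X : Type*} [Nonempty X] {G₁ G₂ : Type*}
    [Group G₁] [Group G₂]
    (h : ∀ N : Subgroup (FreeGroup X), N.Normal → gClosure G₁ N = gClosure G₂ N)
    (h₁ : ∀ g : G₁, IsOfFinOrder g → g = 1) :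
    ∀ g : G₂, IsOfFinOrder g → g = 1 := by
  intro g hg
  obtain ⟨n, hn, hgn⟩ := isOfFinOrder_iff_pow_eq_one.mp hg
  obtain ⟨x⟩ := ‹Nonempty X›
  let N := Subgroup.normalClosure {FreeGroup.of x ^ n}
  have hx : FreeGroup.of x ∈ gClosure G₁ N := mem_gClosure_iff.mpr fun μ hμ ↦ by
    refine h₁ _ (isOfFinOrder_iff_pow_eq_one.mpr ⟨n, hn, ?_⟩)
    rw [← map_pow]
    exact hμ (Subgroup.subset_normalClosure rfl)
  rw [h N Subgroup.normalClosure_normal, mem_gClosure_iff] at hx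
  have hN : N ≤ (FreeGroup.lift fun _ : X ↦ g).ker :=
    Subgroup.normalClosure_le_normal (by simp [MonoidHom.mem_ker, hgn])
  simpa using hx _ hN
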